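/- arXiv:2407.19587 — 5 statements merged into one kernel-verified Lean document; each statement's English description precedes it below -/
import Mathlib

section
/- Let Ξ_ns denote the set of valid no-signalling tripartite behaviours with binary settings and outcomes. Fix a Bell functional B : ({0,1}³ × {0,1}³) → ℝ and a bound β ∈ ℝ, writing B·P := Σ_{a,b,c,x,y,z} B(abc,xyz)·P(abc|xyz). Fix a settings distribution S : {0,1}³ → ℝ with S(xyz) ≥ 0 and Σ_{x,y,z} S(xyz) = 1, and a test factor F : ({0,1}³ × {0,1}³) → ℝ with F(abc,xyz) ≥ 0 for all arguments; for a behaviour P write E_P[F] := Σ_{a,b,c,x,y,z} F(abc,xyz)·P(abc|xyz)·S(xyz). Suppose there exists Q ∈ Ξ_ns with B·Q > β and E_Q[F] ≥ 1, and suppose E_P[F] ≤ 1 for every P ∈ Ξ_ns with B·P = β. Then E_P[F] ≤ 1 for every P ∈ Ξ_ns with B·P ≤ β. -/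
open Finset

/-- A tripartite behaviour with binary settings and outcomes is a valid no-signalling
behaviour if it is nonnegative, normalised, and satisfies the three no-signalling
conditions. -/
def IsNSBehaviour (P : Fin 2 → Fin 2 → Fin 2 → Fin 2 → Fin 2 → Fin 2 → ℝ) : Prop :=
  (∀ a b c x y z, 0 ≤ P a b c x y z) ∧
  (∀ x y z, ∑ a : Fin 2, ∑ b : Fin 2, ∑ c : Fin 2, P a b c x y z = 1) ∧
  (∀ b c x x' y z, ∑ a : Fin 2, P a b c x y z = ∑ a : Fin 2, P a b c x' y z) ∧
  (∀ a c x y y' z, ∑ b : Fin 2, P a b c x y z = ∑ b : Fin 2, P a b c x y' z) ∧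
  (∀ a b x y z z', ∑ c : Fin 2, P a b c x y z = ∑ c : Fin 2, P a b c x y z')

/-- The value `B · P` of a Bell functional `B` on a behaviour `P`. -/
def bellVal (B P : Fin 2 → Fin 2 → Fin 2 → Fin 2 → Fin 2 → Fin 2 → ℝ) : ℝ :=
  ∑ a : Fin 2, ∑ b : Fin 2, ∑ c : Fin 2, ∑ x : Fin 2, ∑ y : Fin 2, ∑ z : Fin 2,
    B a b c x y z * P a b c x y z

/-- The expected value `E_P[F]` of a test factor `F` under a behaviour `P` and settings
distribution `S`. -/
def tfExp (S : Fin 2 → Fin 2 → Fin 2 → ℝ)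
    (F P : Fin 2 → Fin 2 → Fin 2 → Fin 2 → Fin 2 → Fin 2 → ℝ) : ℝ :=
  ∑ a : Fin 2, ∑ b : Fin 2, ∑ c : Fin 2, ∑ x : Fin 2, ∑ y : Fin 2, ∑ z : Fin 2,
    F a b c x y z * P a b c x y z * S x y z

/-- A Bell functional is affine along the segment joining two behaviours. -/
theorem bellVal_mix (B P Q : Fin 2 → Fin 2 → Fin 2 → Fin 2 → Fin 2 → Fin 2 → ℝ) (s t : ℝ) :
    bellVal B (fun a b c x y z => s * P a b c x y z + t * Q a b c x y z) =
      s * bellVal B P + t * bellVal B Q := by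
  simp only [bellVal, mul_sum, ← sum_add_distrib]
  iterate 6 refine sum_congr rfl fun _ _ => ?_
  ring

/-- The expected value of a test factor is affine along the segment joining two behaviours. -/
theorem tfExp_mix (S : Fin 2 → Fin 2 → Fin 2 → ℝ)
    (F P Q : Fin 2 → Fin 2 → Fin 2 → Fin 2 → Fin 2 → Fin 2 → ℝ) (s t : ℝ) :
    tfExp S F (fun a b c x y z => s * P a b c x y z + t * Q a b c x y z) =
      s * tfExp S F P + t * tfExp S F Q := by
  simp only [tfExp, mul_sum, ← sum_add_distrib]
  iterate 6 refine sum_congr rfl fun _ _ => ?_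
  ring

/-- Convex mixtures of no-signalling behaviours are no-signalling. -/
theorem IsNSBehaviour.mix {P Q : Fin 2 → Fin 2 → Fin 2 → Fin 2 → Fin 2 → Fin 2 → ℝ}
    (hP : IsNSBehaviour P) (hQ : IsNSBehaviour Q) {s t : ℝ} (hs : 0 ≤ s) (ht : 0 ≤ t)
    (hst : s + t = 1) :
    IsNSBehaviour (fun a b c x y z => s * P a b c x y z + t * Q a b c x y z) := by
  obtain ⟨hP0, hP1, hPa, hPb, hPc⟩ := hP
  obtain ⟨hQ0, hQ1, hQa, hQb, hQc⟩ := hQ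
  refine ⟨fun a b c x y z => ?_, fun x y z => ?_, fun b c x x' y z => ?_,
    fun a c x y y' z => ?_, fun a b x y z z' => ?_⟩
  · exact add_nonneg (mul_nonneg hs (hP0 ..)) (mul_nonneg ht (hQ0 ..))
  · simp only [sum_add_distrib, ← mul_sum, hP1, hQ1, mul_one, hst]
  · simp only [sum_add_distrib, ← mul_sum, hPa b c x x' y z, hQa b c x x' y z]
  · simp only [sum_add_distrib, ← mul_sum, hPb a c x y y' z, hQb a c x y y' z]
  · simp only [sum_add_distrib, ← mul_sum, hPc a b x y z z', hQc a b x y z z']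

/-- If some no-signalling behaviour `Q` strictly violates the witness `B·P ≤ β` and has
`E_Q[F] ≥ 1`, and `E_P[F] ≤ 1` for every no-signalling `P` saturating the witness, then
`E_P[F] ≤ 1` for every no-signalling `P` obeying the witness. -/
theorem saturation_constraints_suffice
    (B : Fin 2 → Fin 2 → Fin 2 → Fin 2 → Fin 2 → Fin 2 → ℝ) (β : ℝ)
    (S : Fin 2 → Fin 2 → Fin 2 → ℝ)
    (hS0 : ∀ x y z, 0 ≤ S x y z)
    (hS1 : ∑ x : Fin 2, ∑ y : Fin 2, ∑ z : Fin 2, S x y z = 1)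
    (F : Fin 2 → Fin 2 → Fin 2 → Fin 2 → Fin 2 → Fin 2 → ℝ)
    (hF : ∀ a b c x y z, 0 ≤ F a b c x y z)
    (hQ : ∃ Q, IsNSBehaviour Q ∧ β < bellVal B Q ∧ 1 ≤ tfExp S F Q)
    (hsat : ∀ P, IsNSBehaviour P → bellVal B P = β → tfExp S F P ≤ 1) :
    ∀ P, IsNSBehaviour P → bellVal B P ≤ β → tfExp S F P ≤ 1 := by
  intro P hP hPβ
  obtain ⟨Q, hQ, hβQ, hFQ⟩ := hQ
  by_contra! hFP
  have hd : 0 < bellVal B Q - bellVal B P := by linarith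
  set t := (bellVal B Q - β) / (bellVal B Q - bellVal B P)
  have ht0 : 0 < t := div_pos (by linarith) hd
  have ht1 : t ≤ 1 := (div_le_one hd).2 (by linarith)
  have htd : t * (bellVal B Q - bellVal B P) = bellVal B Q - β := div_mul_cancel₀ _ hd.ne'
  have h := hsat _ (hP.mix hQ ht0.le (sub_nonneg.2 ht1) (add_sub_cancel _ _))
    (by rw [bellVal_mix]; linarith)
  rw [tfExp_mix] at h
  have h1 := mul_lt_mul_of_pos_left hFP ht0
  have h2 := mul_le_mul_of_nonneg_left hFQ (sub_nonneg.2 ht1)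
  linarith
end

section
/- Let P be a valid no-signalling behaviour in the (2,2;2,3;2,2) scenario and suppose Σ_{a,b ∈ {0,1}} P(ab0|001) > 0. Define CHSH := Σ_{x,y ∈ {0,1}} (−1)^{x·y} · (Σ_{a,b}(−1)^{a⊕b} P(ab0|xy1)) / (Σ_{a,b} P(ab0|xy1)), M_C¹ := Σ_{a,b,c ∈ {0,1}} (−1)^c P(abc|001), and Same := Σ_{a,b,c ∈ {0,1}} (−1)^{a⊕b} P(abc|020) + Σ_{a,b,c ∈ {0,1}} (−1)^{b⊕c} P(abc|020). Then the inequality CHSH + (4·Same − 8)/(1 + M_C¹) ≤ 2 holds if and only if the linear inequality Σ_{s,t ∈ {0,1}} [ (−1)^{s⊕t} ( P(st0|011) + P(st0|101) − P(st0|111) + 4·P(sts|020) ) − 3^{s⊕t} P(st0|001) ] ≤ 4 holds. -/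
open Finset

/-- A valid no-signalling behaviour in the (2,2;2,3;2,2) tripartite Bell scenario:
outcomes `a b c : Fin 2`, settings `x z : Fin 2`, `y : Fin 3`. -/
def IsNS232 (P : Fin 2 → Fin 2 → Fin 2 → Fin 2 → Fin 3 → Fin 2 → ℝ) : Prop :=
  (∀ a b c x y z, 0 ≤ P a b c x y z) ∧
  (∀ x y z, ∑ a : Fin 2, ∑ b : Fin 2, ∑ c : Fin 2, P a b c x y z = 1) ∧
  (∀ b c x x' y z, ∑ a : Fin 2, P a b c x y z = ∑ a : Fin 2, P a b c x' y z) ∧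
  (∀ a c x y y' z, ∑ b : Fin 2, P a b c x y z = ∑ b : Fin 2, P a b c x y' z) ∧
  (∀ a b x y z z', ∑ c : Fin 2, P a b c x y z = ∑ c : Fin 2, P a b c x y z')

/-- By no-signalling, the marginal of the third party does not depend on the settings of the
other two. -/
lemma IsNS232.sum_sum_eq {P : Fin 2 → Fin 2 → Fin 2 → Fin 2 → Fin 3 → Fin 2 → ℝ}
    (h : IsNS232 P) (c x x' : Fin 2) (y y' : Fin 3) (z : Fin 2) :
    ∑ a : Fin 2, ∑ b : Fin 2, P a b c x y z = ∑ a : Fin 2, ∑ b : Fin 2, P a b c x' y' z := by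
  obtain ⟨-, -, hA, hB, -⟩ := h
  calc ∑ a : Fin 2, ∑ b : Fin 2, P a b c x y z
      = ∑ a : Fin 2, ∑ b : Fin 2, P a b c x y' z := sum_congr rfl fun a _ => hB a c x y y' z
    _ = ∑ b : Fin 2, ∑ a : Fin 2, P a b c x y' z := sum_comm
    _ = ∑ b : Fin 2, ∑ a : Fin 2, P a b c x' y' z := sum_congr rfl fun b _ => hA b c x x' y' z
    _ = ∑ a : Fin 2, ∑ b : Fin 2, P a b c x' y' z := sum_comm

/-- The nonlinear witness of Pan et al. combining the conditional CHSH game with the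
'Same' game is equivalent, for no-signalling behaviours, to an explicit linear
Bell-type inequality. -/
theorem pan_witness_linearisation
    (P : Fin 2 → Fin 2 → Fin 2 → Fin 2 → Fin 3 → Fin 2 → ℝ)
    (hns : IsNS232 P)
    (hpos : 0 < ∑ a : Fin 2, ∑ b : Fin 2, P a b 0 0 0 1) :
    ((∑ x : Fin 2, ∑ y : Fin 2, (-1 : ℝ) ^ ((x * y : Fin 2) : ℕ) *
        ((∑ a : Fin 2, ∑ b : Fin 2, (-1 : ℝ) ^ ((a + b : Fin 2) : ℕ) * P a b 0 x y.castSucc 1) /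
          (∑ a : Fin 2, ∑ b : Fin 2, P a b 0 x y.castSucc 1))) +
      (4 * ((∑ a : Fin 2, ∑ b : Fin 2, ∑ c : Fin 2,
              (-1 : ℝ) ^ ((a + b : Fin 2) : ℕ) * P a b c 0 2 0) +
            (∑ a : Fin 2, ∑ b : Fin 2, ∑ c : Fin 2,
              (-1 : ℝ) ^ ((b + c : Fin 2) : ℕ) * P a b c 0 2 0)) - 8) /
        (1 + ∑ a : Fin 2, ∑ b : Fin 2, ∑ c : Fin 2, (-1 : ℝ) ^ ((c : Fin 2) : ℕ) * P a b c 0 0 1)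
      ≤ 2)
    ↔
    (∑ s : Fin 2, ∑ t : Fin 2,
        ((-1 : ℝ) ^ ((s + t : Fin 2) : ℕ) *
            (P s t 0 0 1 1 + P s t 0 1 0 1 - P s t 0 1 1 1 + 4 * P s t s 0 2 0) -
          (3 : ℝ) ^ ((s + t : Fin 2) : ℕ) * P s t 0 0 0 1)
      ≤ 4) := by
  have hmarg : ∀ (x : Fin 2) (y : Fin 2), ∑ a : Fin 2, ∑ b : Fin 2, P a b 0 x y.castSucc 1 =
      ∑ a : Fin 2, ∑ b : Fin 2, P a b 0 0 0 1 := fun x y => hns.sum_sum_eq 0 x 0 y.castSucc 0 1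
  have hM : 1 + ∑ a : Fin 2, ∑ b : Fin 2, ∑ c : Fin 2,
      (-1 : ℝ) ^ ((c : Fin 2) : ℕ) * P a b c 0 0 1 =
      2 * ∑ a : Fin 2, ∑ b : Fin 2, P a b 0 0 0 1 := by
    have hnorm := hns.2.1 0 0 1
    simp only [Fin.sum_univ_two, Fin.val_zero, Fin.val_one, pow_zero, pow_one] at hnorm ⊢
    linarith
  simp only [hmarg, hM]
  obtain ⟨p, hp⟩ : ∃ p, p = ∑ a : Fin 2, ∑ b : Fin 2, P a b 0 0 0 1 := ⟨_, rfl⟩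
  rw [← hp] at hpos ⊢
  have hdiv : ∀ K S : ℝ, K / p + (4 * S - 8) / (2 * p) ≤ 2 ↔ K + 2 * S - 4 ≤ 2 * p := by
    intro K S
    rw [show K / p + (4 * S - 8) / (2 * p) = (K + 2 * S - 4) / p by field_simp; ring,
      div_le_iff₀ hpos]
  simp only [← mul_div_assoc, ← sum_div, hdiv]
  rw [hp]
  have h11 : (1 + 1 : Fin 2) = 0 := rfl
  have h1 : (1 : Fin 2).castSucc = (1 : Fin 3) := rfl
  have h0 : (0 : Fin 2).castSucc = (0 : Fin 3) := rfl
  simp only [Fin.sum_univ_two, h11, h1, h0, add_zero, zero_add, mul_zero, mul_one,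
    Fin.val_zero, Fin.val_one, pow_zero, pow_one]
  constructor <;> intro h <;> linarith
end

section
/- For every θ ∈ ℝ, the depolarised GHZ behaviour P_θ satisfies W₂(P_θ) = (4 + 4√2)·θ. Consequently, for θ ∈ [0,1], P_θ violates the witness inequality W₂(P) ≤ 8 if and only if θ > 2/(√2 + 1). -/
open Finset

/-- The correlator pattern `G` of the depolarised GHZ behaviour (Table IV of the paper). -/
noncomputable def ghzG (a b c x y z : Fin 2) : ℝ :=
  if x = 0 then
    (if z = 0 then
      (-1 : ℝ) ^ ((a + c : Fin 2) : ℕ) +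
        Real.sqrt 2 * (-1 : ℝ) ^ ((a + b + y : Fin 2) : ℕ) * (if a = c then 1 else 0)
     else (-1 : ℝ) ^ ((a + b + y : Fin 2) : ℕ) / Real.sqrt 2)
  else
    (if z = 0 then (-1 : ℝ) ^ ((b + c + y : Fin 2) : ℕ) / Real.sqrt 2
     else (-1 : ℝ) ^ ((a + b + c : Fin 2) : ℕ) / Real.sqrt 2)

/-- The depolarised GHZ behaviour with visibility `θ`. -/
noncomputable def Pdep (θ : ℝ) (a b c x y z : Fin 2) : ℝ :=
  (1 / 8) * (1 + θ * ghzG a b c x y z)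

/-- Two-party marginal correlator `M_AB^{xy}`. -/
def corrAB (P : Fin 2 → Fin 2 → Fin 2 → Fin 2 → Fin 2 → Fin 2 → ℝ) (x y : Fin 2) : ℝ :=
  ∑ a : Fin 2, ∑ b : Fin 2, ∑ c : Fin 2, (-1 : ℝ) ^ ((a + b : Fin 2) : ℕ) * P a b c x y 0

/-- Two-party marginal correlator `M_BC^{yz}`. -/
def corrBC (P : Fin 2 → Fin 2 → Fin 2 → Fin 2 → Fin 2 → Fin 2 → ℝ) (y z : Fin 2) : ℝ :=
  ∑ a : Fin 2, ∑ b : Fin 2, ∑ c : Fin 2, (-1 : ℝ) ^ ((b + c : Fin 2) : ℕ) * P a b c 0 y z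

/-- Two-party marginal correlator `M_AC^{xz}`. -/
def corrAC (P : Fin 2 → Fin 2 → Fin 2 → Fin 2 → Fin 2 → Fin 2 → ℝ) (x z : Fin 2) : ℝ :=
  ∑ a : Fin 2, ∑ b : Fin 2, ∑ c : Fin 2, (-1 : ℝ) ^ ((a + c : Fin 2) : ℕ) * P a b c x 0 z

/-- Full correlator `C^{xyz}`. -/
def corrABC (P : Fin 2 → Fin 2 → Fin 2 → Fin 2 → Fin 2 → Fin 2 → ℝ) (x y z : Fin 2) : ℝ :=
  ∑ a : Fin 2, ∑ b : Fin 2, ∑ c : Fin 2, (-1 : ℝ) ^ ((a + b + c : Fin 2) : ℕ) * P a b c x y z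

/-- The witness value `W₂(P)` of Eq. (2) of the paper. -/
def W2 (P : Fin 2 → Fin 2 → Fin 2 → Fin 2 → Fin 2 → Fin 2 → ℝ) : ℝ :=
  corrAB P 0 0 - corrAB P 0 1 + corrBC P 0 0 - corrBC P 1 0 +
    2 * corrABC P 1 0 1 + 2 * corrABC P 1 1 1 + 4 * corrAC P 0 0

theorem W2_Pdep (θ : ℝ) : W2 (Pdep θ) = (4 + 4 * Real.sqrt 2) * θ := by
  have inv_sqrt_two : (Real.sqrt 2)⁻¹ = Real.sqrt 2 / 2 :=
    Real.sqrt_div_self.symm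
  simp [W2, corrAB, corrBC, corrAC, corrABC, Pdep, ghzG, Fin.sum_univ_two, div_eq_mul_inv,
    inv_sqrt_two]
  ring

/-- The depolarised GHZ behaviour has witness value `(4 + 4√2)θ`, and for `θ ∈ [0,1]` it
violates the witness inequality `W₂(P) ≤ 8` exactly when `θ > 2/(√2 + 1)`. -/
theorem W2_depolarised_ghz :
    (∀ θ : ℝ, W2 (Pdep θ) = (4 + 4 * Real.sqrt 2) * θ) ∧
      (∀ θ : ℝ, 0 ≤ θ → θ ≤ 1 →
        (8 < W2 (Pdep θ) ↔ 2 / (Real.sqrt 2 + 1) < θ)) := by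
  refine ⟨W2_Pdep, fun θ _ _ => ?_⟩
  rw [W2_Pdep, div_lt_iff₀ (by positivity)]
  constructor <;> intro h <;> linarith
end

section
/- For every θ ∈ [0,1], the depolarised GHZ behaviour P_θ is a valid no-signalling behaviour: all entries P_θ(abc|xyz) are nonnegative, Σ_{a,b,c} P_θ(abc|xyz) = 1 for every setting triple, and P_θ satisfies the three no-signalling conditions. -/
open Finset

theorem neg_one_le_ghzG (a b c x y z : Fin 2) : -1 ≤ ghzG a b c x y z := by
  have h₂ : √2 ≤ 2 := Real.sqrt_le_iff.2 (by norm_num)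
  have h₀ : 0 ≤ √2 := Real.sqrt_nonneg 2
  have hdiv (n : ℕ) : (-1 : ℝ) ^ n / √2 = (-1) ^ n * (√2 / 2) := by
    rw [Real.sqrt_div_self', mul_one_div]
  simp only [ghzG, hdiv]
  fin_cases a <;> fin_cases b <;> fin_cases c <;> fin_cases x <;> fin_cases y <;> fin_cases z <;>
    norm_num [Fin.val_add] <;> linarith

theorem sum_ghzG_fst (b c x x' y z : Fin 2) :
    ∑ a, ghzG a b c x y z = ∑ a, ghzG a b c x' y z := by
  have hdiv (n : ℕ) : (-1 : ℝ) ^ n / √2 = (-1) ^ n * (√2 / 2) := by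
    rw [Real.sqrt_div_self', mul_one_div]
  simp only [ghzG, hdiv, Fin.sum_univ_two]
  fin_cases b <;> fin_cases c <;> fin_cases x <;> fin_cases x' <;> fin_cases y <;> fin_cases z <;>
    norm_num [Fin.val_add] <;> ring

theorem ghzG_swap (a b c x y z : Fin 2) : ghzG a b c x y z = ghzG c b a z y x := by
  fin_cases a <;> fin_cases c <;> fin_cases x <;> fin_cases z <;>
    simp [ghzG, add_comm, add_left_comm]

theorem sum_ghzG_snd (a c x y y' z : Fin 2) :
    ∑ b, ghzG a b c x y z = ∑ b, ghzG a b c x y' z := by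
  simp only [ghzG, Fin.sum_univ_two]
  fin_cases a <;> fin_cases c <;> fin_cases x <;> fin_cases y <;> fin_cases y' <;>
    fin_cases z <;> norm_num [Fin.val_add] <;> ring

theorem sum_ghzG (x y z : Fin 2) : ∑ a, ∑ b, ∑ c, ghzG a b c x y z = 0 := by
  simp only [ghzG, Fin.sum_univ_two]
  fin_cases x <;> fin_cases y <;> fin_cases z <;> norm_num [Fin.val_add] <;> ring

/-- For every visibility `θ ∈ [0,1]` the depolarised GHZ behaviour is a valid
no-signalling behaviour. -/
theorem depolarised_ghz_is_no_signalling (θ : ℝ) (hθ0 : 0 ≤ θ) (hθ1 : θ ≤ 1) :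
    IsNSBehaviour (Pdep θ) := by
  refine ⟨fun a b c x y z ↦ ?_, fun x y z ↦ ?_, fun b c x x' y z ↦ ?_,
    fun a c x y y' z ↦ ?_, fun a b x y z z' ↦ ?_⟩
  · have := mul_le_mul_of_nonneg_left (neg_one_le_ghzG a b c x y z) hθ0
    unfold Pdep
    linarith
  · simp only [Pdep, ← mul_sum, sum_add_distrib, sum_ghzG]
    norm_num
  · simp only [Pdep, ← mul_sum, sum_add_distrib, sum_ghzG_fst b c x x' y z]
  · simp only [Pdep, ← mul_sum, sum_add_distrib, sum_ghzG_snd a c x y y' z]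
  · simp only [Pdep, ghzG_swap a b, ← mul_sum, sum_add_distrib, sum_ghzG_fst b a z z' y x]
end

section
/- Let Z = [[1,0],[0,−1]] and X = [[0,1],[1,0]] be the 2×2 Pauli matrices over ℂ, I the 2×2 identity matrix, and |GHZ⟩ = (e₀⊗e₀⊗e₀ + e₁⊗e₁⊗e₁)/√2 ∈ ℂ⁸ (Kronecker products of the standard basis vectors of ℂ²). Define observables A₀ = Z, A₁ = X, B₀ = (X+Z)/√2, B₁ = (X−Z)/√2, C₀ = Z, C₁ = X, and for an observable O and outcome a ∈ {0,1} the projector Π_a(O) := (I + (−1)^a O)/2. Then for all a,b,c,x,y,z ∈ {0,1}, the quantum behaviour P(abc|xyz) := ⟨GHZ| (Π_a(A_x) ⊗ Π_b(B_y) ⊗ Π_c(C_z)) |GHZ⟩ (the inner product, which is real) equals (1/8)·(1 + G(abc,xyz)), where G(abc,xyz) = (−1)^{a⊕c} + √2·(−1)^{a⊕b⊕y}·[a = c] if x = z = 0 (with [a = c] equal to 1 if a = c and 0 otherwise), G = (−1)^{a⊕b⊕y}/√2 if x = 0 and z = 1, G = (−1)^{b⊕c⊕y}/√2 if x = 1 and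 z = 0, and G = (−1)^{a⊕b⊕c}/√2 if x = 1 and z = 1. -/
open Matrix Kronecker Finset

/-- Pauli `Z` matrix. -/
noncomputable def pauliZ : Matrix (Fin 2) (Fin 2) ℂ := !![1, 0; 0, -1]

/-- Pauli `X` matrix. -/
noncomputable def pauliX : Matrix (Fin 2) (Fin 2) ℂ := !![0, 1; 1, 0]

/-- Measurement observables of party `A`: `A₀ = Z`, `A₁ = X`. -/
noncomputable def obsA : Fin 2 → Matrix (Fin 2) (Fin 2) ℂ := ![pauliZ, pauliX]

/-- Measurement observables of party `B`: `B₀ = (X+Z)/√2`, `B₁ = (X−Z)/√2`. -/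
noncomputable def obsB : Fin 2 → Matrix (Fin 2) (Fin 2) ℂ :=
  ![((Real.sqrt 2 : ℂ))⁻¹ • (pauliX + pauliZ), ((Real.sqrt 2 : ℂ))⁻¹ • (pauliX - pauliZ)]

/-- Measurement observables of party `C`: `C₀ = Z`, `C₁ = X`. -/
noncomputable def obsC : Fin 2 → Matrix (Fin 2) (Fin 2) ℂ := ![pauliZ, pauliX]

/-- Projector onto the outcome `a ∈ {0,1}` of a binary observable `O`:
`Π_a(O) = (I + (−1)^a O)/2`. -/
noncomputable def outProj (a : Fin 2) (O : Matrix (Fin 2) (Fin 2) ℂ) :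
    Matrix (Fin 2) (Fin 2) ℂ :=
  (2 : ℂ)⁻¹ • ((1 : Matrix (Fin 2) (Fin 2) ℂ) + ((-1 : ℂ) ^ (a : ℕ)) • O)

/-- Standard basis vector `e_i` of `ℂ²`. -/
def stdVec (i : Fin 2) : Fin 2 → ℂ := fun j => if j = i then 1 else 0

/-- Kronecker product of vectors. -/
def vkron {α β : Type*} (u : α → ℂ) (v : β → ℂ) : α × β → ℂ := fun p => u p.1 * v p.2

/-- The GHZ state `(e₀⊗e₀⊗e₀ + e₁⊗e₁⊗e₁)/√2` as a vector of `ℂ⁸`. -/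
noncomputable def ghz : (Fin 2 × Fin 2) × Fin 2 → ℂ :=
  ((Real.sqrt 2 : ℂ))⁻¹ •
    (vkron (vkron (stdVec 0) (stdVec 0)) (stdVec 0) +
      vkron (vkron (stdVec 1) (stdVec 1)) (stdVec 1))

/-- The GHZ expectation of a product operator is half the sum of its entrywise products. -/
theorem ghz_expectation_kronecker (M N L : Matrix (Fin 2) (Fin 2) ℂ) :
    star ghz ⬝ᵥ (((M ⊗ₖ N) ⊗ₖ L) *ᵥ ghz) =
      (2 : ℂ)⁻¹ * ∑ i, ∑ j, M i j * N i j * L i j := by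
  have h : ((Real.sqrt 2 : ℂ))⁻¹ * ((Real.sqrt 2 : ℂ))⁻¹ = (2 : ℂ)⁻¹ := by
    rw [← mul_inv, ← Complex.ofReal_mul, Real.mul_self_sqrt zero_le_two, Complex.ofReal_ofNat]
  rw [← h]
  simp [ghz, vkron, stdVec, dotProduct, mulVec, Fintype.sum_prod_type, Fin.sum_univ_two,
    kroneckerMap_apply]
  ring

theorem neg_one_pow_val_add {R : Type*} [Ring R] (a b : Fin 2) :
    (-1 : R) ^ ((a + b : Fin 2) : ℕ) = (-1) ^ (a : ℕ) * (-1) ^ (b : ℕ) := by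
  fin_cases a <;> fin_cases b <;> simp

theorem ite_eq_eq_neg_one_pow (a c : Fin 2) :
    (if a = c then 1 else 0 : ℝ) = (1 + (-1) ^ (a : ℕ) * (-1) ^ (c : ℕ)) / 2 := by
  fin_cases a <;> fin_cases c <;> norm_num

/-- The quantum behaviour of the ideal GHZ protocol equals the perfect GHZ behaviour
`(1/8)(1 + G)`. -/
theorem ghz_protocol_behaviour :
    ∀ a b c x y z : Fin 2,
      star ghz ⬝ᵥ
          (((outProj a (obsA x) ⊗ₖ outProj b (obsB y)) ⊗ₖ outProj c (obsC z)) *ᵥ ghz) =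
        (((1 / 8) * (1 + ghzG a b c x y z) : ℝ) : ℂ) := by
  intro a b c x y z
  have h : ((Real.sqrt 2 : ℂ)) ^ 2 = 2 := by
    rw [← Complex.ofReal_pow, Real.sq_sqrt zero_le_two, Complex.ofReal_ofNat]
  rw [ghz_expectation_kronecker]
  have h_sign (a : Fin 2) : ((-1 : ℂ) ^ (a : ℕ)) ^ 2 = 1 := by
    rw [← pow_mul, mul_comm, pow_mul, neg_one_sq, one_pow]
  have ha := h_sign a
  have hb := h_sign b
  have hc := h_sign c
  fin_cases x <;> fin_cases z <;> fin_cases y <;>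
    simp [outProj, obsA, obsB, obsC, pauliX, pauliZ, ghzG, Fin.sum_univ_two,
      neg_one_pow_val_add, ite_eq_eq_neg_one_pow, -mul_ite] <;>
    generalize (-1 : ℂ) ^ (a : ℕ) = α at * <;>
    generalize (-1 : ℂ) ^ (b : ℕ) = β at * <;>
    generalize (-1 : ℂ) ^ (c : ℕ) = γ at * <;>
    field_simp <;> grind only
end
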